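/- Let τ be a finite set of unary relation symbols and let M and N be finite nonempty τ-structures with the same characteristic vector (for every atomic 1-type π over τ, |π|_M = |π|_N). Then for every sentence φ of the one-variable Presburger logic P¹ over τ, M satisfies φ if and only if N satisfies φ. -/

import Mathlib

/- Syntax of the one-variable Presburger logic `P¹` over a signature `τ` of
unary relation symbols.  Counting terms are sums of expressions `a·#x[φ]` with
`a` a non-zero integer; formulas are built from atoms `P(x)` by negation,
conjunction, threshold constraints `t ≥ b` (`b ∈ ℕ`) and modular constraints
`t ≡_c d` (`c` a positive integer, `d ∈ {0,…,c−1}`). -/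
mutual
inductive PTerm (τ : Type) : Type
  | add : PTerm τ → PTerm τ → PTerm τ
  | count : (a : ℤ) → a ≠ 0 → PFormula τ → PTerm τ

inductive PFormula (τ : Type) : Type
  | atom : τ → PFormula τ
  | not : PFormula τ → PFormula τ
  | and : PFormula τ → PFormula τ → PFormula τ
  | ge : PTerm τ → ℕ → PFormula τ
  | mod : PTerm τ → (c : ℕ) → 0 < c → (d : ℕ) → d < c → PFormula τ
end

/- Semantics of `P¹` in a finite structure with universe `M` and interpretation
`interp`: the value of `#x[φ]` is the number of elements satisfying `φ`, terms
are evaluated in `ℤ`. -/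
mutual
def PTerm.val {τ M : Type} [Fintype M] (interp : τ → M → Bool) : PTerm τ → ℤ
  | .add t₁ t₂ => t₁.val interp + t₂.val interp
  | .count a _ φ => a * ((Finset.univ.filter (fun x => φ.sat interp x = true)).card : ℤ)

def PFormula.sat {τ M : Type} [Fintype M] (interp : τ → M → Bool) : PFormula τ → M → Bool
  | .atom P, x => interp P x
  | .not φ, x => !(φ.sat interp x)
  | .and φ ψ, x => φ.sat interp x && ψ.sat interp x
  | .ge t b, _ => decide ((b : ℤ) ≤ t.val interp)
  | .mod t c _ d _, _ => decide (t.val interp % (c : ℤ) = (d : ℤ))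
end

/-- A `P¹` formula is a *sentence* if the variable `x` has no free occurrence,
i.e. every atom occurs inside a counting term. -/
def PFormula.IsSentence {τ : Type} : PFormula τ → Prop
  | .atom _ => False
  | .not φ => φ.IsSentence
  | .and φ ψ => φ.IsSentence ∧ ψ.IsSentence
  | .ge _ _ => True
  | .mod _ _ _ _ _ => True

/-- `charVec interp π` is `|π|_M`: the number of elements of the structure of
atomic 1-type `π : τ → Bool`. -/
def charVec {τ M : Type} [Fintype τ] [DecidableEq τ] [Fintype M]
    (interp : τ → M → Bool) (π : τ → Bool) : ℕ :=
  (Finset.univ.filter (fun a : M => (fun P => interp P a) = π)).card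

mutual
theorem PTerm.val_iso {τ M N : Type} [Fintype M] [Fintype N]
    (iM : τ → M → Bool) (iN : τ → N → Bool) (e : M ≃ N)
    (he : ∀ P a, iN P (e a) = iM P a) : ∀ t : PTerm τ, t.val iM = t.val iN
  | .add t₁ t₂ => by
    rw [PTerm.val, PTerm.val, PTerm.val_iso iM iN e he t₁, PTerm.val_iso iM iN e he t₂]
  | .count a _ φ => by
    have key := PFormula.sat_iso iM iN e he φ
    rw [PTerm.val, PTerm.val]
    congr 2
    refine Finset.card_equiv e fun x => ?_
    simp [key x]

theorem PFormula.sat_iso {τ M N : Type} [Fintype M] [Fintype N]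
    (iM : τ → M → Bool) (iN : τ → N → Bool) (e : M ≃ N)
    (he : ∀ P a, iN P (e a) = iM P a) :
    ∀ (φ : PFormula τ) (x : M), φ.sat iM x = φ.sat iN (e x)
  | .atom P, x => by rw [PFormula.sat, PFormula.sat, he]
  | .not φ, x => by
    rw [PFormula.sat, PFormula.sat, PFormula.sat_iso iM iN e he φ x]
  | .and φ ψ, x => by
    rw [PFormula.sat, PFormula.sat, PFormula.sat_iso iM iN e he φ x,
      PFormula.sat_iso iM iN e he ψ x]
  | .ge t b, x => by
    rw [PFormula.sat, PFormula.sat, PTerm.val_iso iM iN e he t]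
  | .mod t c _ d _, x => by
    rw [PFormula.sat, PFormula.sat, PTerm.val_iso iM iN e he t]
end

theorem exists_iso_of_charVec {τ M N : Type} [Fintype τ] [DecidableEq τ]
    [Fintype M] [Fintype N] (iM : τ → M → Bool) (iN : τ → N → Bool)
    (h : ∀ π : τ → Bool, charVec iM π = charVec iN π) :
    ∃ e : M ≃ N, ∀ P a, iN P (e a) = iM P a := by
  have hf : ∀ π : τ → Bool, Nonempty
      ({a : M // (fun P => iM P a) = π} ≃ {b : N // (fun P => iN P b) = π}) := by
    intro π
    refine ⟨Fintype.equivOfCardEq ?_⟩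
    have := h π
    rw [charVec, charVec] at this
    rw [Fintype.card_subtype, Fintype.card_subtype, this]
  let F : ∀ π : τ → Bool,
      {a : M // (fun P => iM P a) = π} ≃ {b : N // (fun P => iN P b) = π} :=
    fun π => (hf π).some
  refine ⟨Equiv.ofFiberEquiv (f := fun a P => iM P a) (g := fun b P => iN P b) F, ?_⟩
  intro P a
  exact congrFun (Equiv.ofFiberEquiv_map (f := fun a P => iM P a)
    (g := fun b P => iN P b) F a) P

/-- Two finite nonempty structures with the same characteristic vector satisfy
exactly the same sentences of the one-variable Presburger logic `P¹`. -/
theorem charVec_determines_P1_sentences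
    {τ M N : Type} [Fintype τ] [DecidableEq τ]
    [Fintype M] [Nonempty M] [Fintype N] [Nonempty N]
    (iM : τ → M → Bool) (iN : τ → N → Bool)
    (h : ∀ π : τ → Bool, charVec iM π = charVec iN π)
    (φ : PFormula τ) (hφ : φ.IsSentence) :
    (∀ a : M, PFormula.sat iM φ a = true) ↔ (∀ b : N, PFormula.sat iN φ b = true) := by
  obtain ⟨e, he⟩ := exists_iso_of_charVec iM iN h
  rw [← e.forall_congr_right]
  simp only [PFormula.sat_iso iM iN e he φ]
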